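/- arXiv:1705.07918 — 9 statements merged into one kernel-verified Lean document; each statement's English description precedes it below -/
import Mathlib

section
/- Let e be an empirical model on a measurement scenario (X, M, O) and let λ ∈ (0,1). Then there exists a subprobability distribution b on O^X of weight λ satisfying b|_C(s) ≤ e_C(s) for all C ∈ M and s ∈ O^C if and only if there exist a non-contextual empirical model e^NC and an empirical model e' on (X, M, O) such that e_C = λ · e^NC_C + (1−λ) · e'_C for every C ∈ M. Consequently, NCF(e) equals the maximum λ admitting such a convex decomposition. -/
open Finset

/-- Assignments of outcomes in `O` to the measurements in a context `C`. -/
abbrev Assign {X : Type} (C : Finset X) (O : Type) : Type := {x // x ∈ C} → O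

variable {X O : Type} [Fintype X] [DecidableEq X] [Fintype O] [DecidableEq O]

/-- Marginalisation of a distribution on assignments on `C` to a subset `U ⊆ C`. -/
noncomputable def marg {C U : Finset X} (h : U ⊆ C) (d : Assign C O → ℝ) :
    Assign U O → ℝ :=
  fun t => ∑ s ∈ univ.filter
    (fun s : Assign C O => ∀ u : {x // x ∈ U}, s ⟨u.1, h u.2⟩ = t u), d s

/-- Marginalisation of a distribution on global assignments to a context `C`. -/
noncomputable def margG (C : Finset X) (d : (X → O) → ℝ) : Assign C O → ℝ :=
  fun t => ∑ g ∈ univ.filter (fun g : X → O => ∀ x : {x // x ∈ C}, g x.1 = t x), d g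

/-- `d` is a probability distribution on the finite type `α`. -/
def IsProb {α : Type} [Fintype α] (d : α → ℝ) : Prop :=
  (∀ a, 0 ≤ d a) ∧ ∑ a, d a = 1

/-- An empirical model on the scenario `(X, M, O)`: a probability distribution on each
context of `M`, compatible on overlaps. -/
def IsEmpiricalModel (M : Finset (Finset X)) (e : ∀ C : Finset X, Assign C O → ℝ) : Prop :=
  (∀ C ∈ M, IsProb (e C)) ∧
  ∀ C ∈ M, ∀ C' ∈ M,
    marg (inter_subset_left : C ∩ C' ⊆ C) (e C) =
    marg (inter_subset_right : C ∩ C' ⊆ C') (e C')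

/-- A model is non-contextual if it is the marginalisation of a probability
distribution on global assignments. -/
def NonContextual (M : Finset (Finset X)) (e : ∀ C : Finset X, Assign C O → ℝ) : Prop :=
  ∃ d : (X → O) → ℝ, IsProb d ∧ ∀ C ∈ M, margG C d = e C

/-- A model is strongly contextual if no global assignment is consistent with its support. -/
def StronglyContextual (M : Finset (Finset X)) (e : ∀ C : Finset X, Assign C O → ℝ) : Prop :=
  ¬ ∃ g : X → O, ∀ C ∈ M, 0 < e C (fun x => g x.1)

/-- `b` is a subprobability distribution on global assignments whose marginals are
  dominated by the empirical model `e`. -/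
def Feasible (M : Finset (Finset X)) (e : ∀ C : Finset X, Assign C O → ℝ)
    (b : (X → O) → ℝ) : Prop :=
  (∀ g, 0 ≤ b g) ∧ (∑ g, b g) ≤ 1 ∧ ∀ C ∈ M, ∀ t, margG C b t ≤ e C t

/-- The non-contextual fraction: the maximum weight of a subprobability distribution on
global assignments dominated by `e`. -/
noncomputable def NCF (M : Finset (Finset X)) (e : ∀ C : Finset X, Assign C O → ℝ) : ℝ :=
  sSup {w | ∃ b : (X → O) → ℝ, Feasible M e b ∧ ∑ g, b g = w}

/-- The contextual fraction. -/
noncomputable def CF (M : Finset (Finset X)) (e : ∀ C : Finset X, Assign C O → ℝ) : ℝ :=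
  1 - NCF M e

theorem margG_nonneg {C : Finset X} {d : (X → O) → ℝ} (hd : ∀ g, 0 ≤ d g) (t : Assign C O) :
    0 ≤ margG C d t :=
  sum_nonneg fun g _ => hd g

theorem margG_const_mul (C : Finset X) (c : ℝ) (d : (X → O) → ℝ) (t : Assign C O) :
    margG C (fun g => c * d g) t = c * margG C d t := by
  simp only [margG, mul_sum]

theorem sum_margG (C : Finset X) (d : (X → O) → ℝ) : ∑ t, margG C d t = ∑ g, d g := by
  rw [← sum_fiberwise univ (fun g : X → O => (fun x => g x.1 : Assign C O)) d]
  simp only [margG, funext_iff]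

/-- Marginalising in two steps is the same as marginalising directly. -/
theorem marg_margG {C U : Finset X} (h : U ⊆ C) (d : (X → O) → ℝ) :
    marg h (margG C d) = margG U d := by
  funext t
  have hmaps : ∀ g ∈ univ.filter (fun g : X → O => ∀ x : {x // x ∈ U}, g x.1 = t x),
      (fun x => g x.1 : Assign C O) ∈
        univ.filter (fun s : Assign C O => ∀ u : {x // x ∈ U}, s ⟨u.1, h u.2⟩ = t u) := by
    intro g hg
    simpa using hg
  unfold marg margG
  rw [← sum_fiberwise_of_maps_to hmaps]
  refine sum_congr rfl fun s hs => sum_congr ?_ fun _ _ => rfl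
  ext g
  simp only [mem_filter, mem_univ, true_and, funext_iff] at hs ⊢
  exact ⟨fun hg => ⟨fun u => (hg ⟨u.1, h u.2⟩).trans (hs u), hg⟩, fun hg => hg.2⟩

theorem marg_sub_div {X O : Type} [DecidableEq X] [Fintype O] [DecidableEq O]
    {C U : Finset X} (h : U ⊆ C) (d d' : Assign C O → ℝ) (c : ℝ) :
    marg h (fun s => (d s - d' s) / c) = fun t => (marg h d t - marg h d' t) / c := by
  funext t
  simp only [marg, ← sum_sub_distrib, sum_div]

theorem IsProb.margG {d : (X → O) → ℝ} (hd : IsProb d) (C : Finset X) :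
    IsProb (margG C d) :=
  ⟨margG_nonneg hd.1, (sum_margG C d).trans hd.2⟩

theorem IsProb.isEmpiricalModel_margG {d : (X → O) → ℝ} (hd : IsProb d)
    (M : Finset (Finset X)) : IsEmpiricalModel M (fun C => _root_.margG C d) :=
  ⟨fun C _ => hd.margG C, fun C _ C' _ => by rw [marg_margG, marg_margG]⟩

theorem exists_isProb_eq_mul {α : Type} [Fintype α] [Nonempty α] {b : α → ℝ}
    (hb : ∀ a, 0 ≤ b a) : ∃ d, IsProb d ∧ ∀ a, b a = (∑ a', b a') * d a := by
  classical
  rcases eq_or_ne (∑ a, b a) 0 with h | h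
  · refine ⟨Pi.single (Classical.arbitrary α) 1, ⟨fun a => ?_, by simp⟩, fun a => ?_⟩
    · simp only [Pi.single_apply]
      split_ifs <;> norm_num
    · rw [h, zero_mul]
      exact (sum_eq_zero_iff_of_nonneg fun a _ => hb a).1 h a (mem_univ a)
  · refine ⟨fun a => b a / ∑ a', b a', ⟨fun a => ?_, ?_⟩, fun a => ?_⟩
    · exact div_nonneg (hb a) (sum_nonneg fun a _ => hb a)
    · rw [← sum_div, div_self h]
    · field_simp

/-- Removing from `e` a dominated subprobability distribution of weight less than `1` and
renormalising leaves an empirical model. -/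
theorem Feasible.isEmpiricalModel_sub_div {M : Finset (Finset X)}
    {e : ∀ C : Finset X, Assign C O → ℝ} {b : (X → O) → ℝ} (hb : Feasible M e b)
    (he : IsEmpiricalModel M e) (h : ∑ g, b g < 1) :
    IsEmpiricalModel M (fun C s => (e C s - margG C b s) / (1 - ∑ g, b g)) := by
  refine ⟨fun C hC => ⟨fun s => ?_, ?_⟩, fun C hC C' hC' => ?_⟩
  · exact div_nonneg (sub_nonneg.2 (hb.2.2 C hC s)) (sub_pos.2 h).le
  · rw [← sum_div, sum_sub_distrib, sum_margG, (he.1 C hC).2, div_self (sub_pos.2 h).ne']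
  · rw [marg_sub_div, marg_sub_div, he.2 C hC C' hC', marg_margG, marg_margG]

/-- A dominated distribution of weight `1` has the contextwise distributions of `e` as its
marginals. -/
theorem Feasible.margG_eq {M : Finset (Finset X)}
    {e : ∀ C : Finset X, Assign C O → ℝ} {b : (X → O) → ℝ} (hb : Feasible M e b)
    (he : IsEmpiricalModel M e) (h : ∑ g, b g = 1) {C : Finset X} (hC : C ∈ M)
    (s : Assign C O) : margG C b s = e C s :=
  (sum_eq_sum_iff_of_le fun t _ => hb.2.2 C hC t).1
    (by rw [sum_margG, h, (he.1 C hC).2]) s (mem_univ s)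

theorem exists_feasible_iff_exists_decomposition [Nonempty O] {M : Finset (Finset X)}
    {e : ∀ C : Finset X, Assign C O → ℝ} (he : IsEmpiricalModel M e) {lam : ℝ}
    (h0 : 0 ≤ lam) (h1 : lam ≤ 1) :
    (∃ b : (X → O) → ℝ, Feasible M e b ∧ ∑ g, b g = lam) ↔
      (∃ eNC e' : ∀ C : Finset X, Assign C O → ℝ,
        IsEmpiricalModel M eNC ∧ NonContextual M eNC ∧ IsEmpiricalModel M e' ∧
        ∀ C ∈ M, ∀ s, e C s = lam * eNC C s + (1 - lam) * e' C s) := by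
  constructor
  · rintro ⟨b, hb, rfl⟩
    obtain ⟨d, hd, hbd⟩ := exists_isProb_eq_mul hb.1
    have hmarg : ∀ C s, margG C b s = (∑ g, b g) * margG C d s := fun C s => by
      rw [← margG_const_mul, ← funext hbd]
    rcases h1.eq_or_lt with h | h
    · refine ⟨_, e, hd.isEmpiricalModel_margG M, ⟨d, hd, fun _ _ => rfl⟩, he,
        fun C hC s => ?_⟩
      rw [← hmarg, hb.margG_eq he h hC, h]
      ring
    · refine ⟨_, _, hd.isEmpiricalModel_margG M, ⟨d, hd, fun _ _ => rfl⟩,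
        hb.isEmpiricalModel_sub_div he h, fun C hC s => ?_⟩
      rw [← hmarg, mul_div_cancel₀ _ (sub_pos.2 h).ne']
      ring
  · rintro ⟨eNC, e', -, ⟨d, hd, hdC⟩, he', hdec⟩
    have hsum : ∑ g, lam * d g = lam := by rw [← mul_sum, hd.2, mul_one]
    refine ⟨fun g => lam * d g,
      ⟨fun g => mul_nonneg h0 (hd.1 g), hsum.trans_le h1, fun C hC t => ?_⟩, hsum⟩
    rw [margG_const_mul, hdC C hC, hdec C hC]
    exact le_add_of_nonneg_right (mul_nonneg (sub_nonneg.2 h1) ((he'.1 C hC).1 t))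

/-- For `λ ∈ (0,1)`, there is a subprobability distribution on global
assignments of weight `λ` dominated by `e` iff `e` decomposes as
`λ·e^NC + (1-λ)·e'` with `e^NC` non-contextual; consequently `NCF(e)` is the maximum
such `λ`. -/
theorem contextual_fraction_convex_decomposition
    {X O : Type} [Fintype X] [DecidableEq X] [Fintype O] [DecidableEq O] [Nonempty O]
    (M : Finset (Finset X)) (e : ∀ C : Finset X, Assign C O → ℝ)
    (he : IsEmpiricalModel M e) :
    (∀ lam : ℝ, 0 < lam → lam < 1 →
      ((∃ b : (X → O) → ℝ, Feasible M e b ∧ ∑ g, b g = lam) ↔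
        (∃ eNC e' : ∀ C : Finset X, Assign C O → ℝ,
          IsEmpiricalModel M eNC ∧ NonContextual M eNC ∧ IsEmpiricalModel M e' ∧
          ∀ C ∈ M, ∀ s, e C s = lam * eNC C s + (1 - lam) * e' C s))) ∧
    NCF M e = sSup {lam : ℝ | 0 ≤ lam ∧ lam ≤ 1 ∧
      ∃ eNC e' : ∀ C : Finset X, Assign C O → ℝ,
        IsEmpiricalModel M eNC ∧ NonContextual M eNC ∧ IsEmpiricalModel M e' ∧
        ∀ C ∈ M, ∀ s, e C s = lam * eNC C s + (1 - lam) * e' C s} := by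
  refine ⟨fun lam h0 h1 => exists_feasible_iff_exists_decomposition he h0.le h1.le, ?_⟩
  unfold NCF
  congr 1
  ext lam
  constructor
  · rintro ⟨b, hb, rfl⟩
    have h0 : 0 ≤ ∑ g, b g := sum_nonneg fun g _ => hb.1 g
    exact ⟨h0, hb.2.1, (exists_feasible_iff_exists_decomposition he h0 hb.2.1).1 ⟨b, hb, rfl⟩⟩
  · rintro ⟨h0, h1, hdec⟩
    exact (exists_feasible_iff_exists_decomposition he h0 h1).2 hdec
end

section
/- An empirical model e on a measurement scenario (X, M, O) is strongly contextual if and only if NCF(e) = 0 (equivalently, its contextual fraction CF(e) equals 1). -/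
open Finset

variable {X O : Type} [Fintype X] [DecidableEq X] [Fintype O] [DecidableEq O]

/-- The weight a distribution gives to a global assignment is at most the weight its marginal
gives to the restriction of that assignment. -/
lemma le_margG (C : Finset X) {b : (X → O) → ℝ} (hb : ∀ g, 0 ≤ b g) (g : X → O) :
    b g ≤ margG C b (fun x => g x.1) := by
  unfold margG
  exact single_le_sum (f := b) (fun g' _ => hb g') (by simp)

/-- A feasible distribution for a strongly contextual model vanishes. -/
lemma StronglyContextual.eq_zero_of_feasible {M : Finset (Finset X)}
    {e : ∀ C : Finset X, Assign C O → ℝ} (h : StronglyContextual M e)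
    {b : (X → O) → ℝ} (hb : Feasible M e b) (g : X → O) : b g = 0 := by
  obtain ⟨hb0, -, hbe⟩ := hb
  by_contra hg
  exact h ⟨g, fun C hC => ((hb0 g).lt_of_ne' hg).trans_le
    ((le_margG C hb0 g).trans (hbe C hC _))⟩

/-- The weight of a feasible distribution is at most the non-contextual fraction. -/
lemma Feasible.sum_le_ncf {M : Finset (Finset X)} {e : ∀ C : Finset X, Assign C O → ℝ}
    {b : (X → O) → ℝ} (hb : Feasible M e b) : ∑ g, b g ≤ NCF M e :=
  le_csSup ⟨1, by rintro w ⟨b', hb', rfl⟩; exact hb'.2.1⟩ ⟨b, hb, rfl⟩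

/-- The point mass at a global assignment `g`, scaled by `p`, is feasible when `p` bounds the
probabilities of the restrictions of `g` from below. -/
lemma feasible_single {M : Finset (Finset X)} {e : ∀ C : Finset X, Assign C O → ℝ}
    (he : ∀ C ∈ M, ∀ t, 0 ≤ e C t) {g : X → O} {p : ℝ} (hp : 0 ≤ p) (hp1 : p ≤ 1)
    (hpe : ∀ C ∈ M, p ≤ e C (fun x => g x.1)) : Feasible M e (Pi.single g p) := by
  refine ⟨fun g' => ?_, by simpa using hp1, fun C hC t => ?_⟩
  · exact (Pi.single_nonneg.2 hp : (0 : (X → O) → ℝ) ≤ Pi.single g p) g'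
  · unfold margG
    rw [sum_pi_single']
    split_ifs with h
    · obtain rfl : (fun x => g x.1) = t := funext (by simpa using h)
      exact hpe C hC
    · exact he C hC t

/-- A finite family of positive reals has a positive lower bound not exceeding `1`. -/
lemma exists_pos_le_one_forall_le {ι : Type*} (s : Finset ι) {f : ι → ℝ}
    (hf : ∀ i ∈ s, 0 < f i) : ∃ p : ℝ, 0 < p ∧ p ≤ 1 ∧ ∀ i ∈ s, p ≤ f i := by
  classical
  have hne : (insert 1 (s.image f)).Nonempty := insert_nonempty _ _
  refine ⟨(insert 1 (s.image f)).min' hne, ?_, min'_le _ _ (by simp), fun i hi =>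
    min'_le _ _ (mem_insert_of_mem (mem_image_of_mem f hi))⟩
  rw [lt_min'_iff]
  simpa using hf

/-- An empirical model is strongly contextual iff its non-contextual
fraction is `0`, equivalently iff its contextual fraction is `1`. -/
theorem stronglyContextual_iff_ncf_eq_zero
    {X O : Type} [Fintype X] [DecidableEq X] [Fintype O] [DecidableEq O] [Nonempty O]
    (M : Finset (Finset X)) (e : ∀ C : Finset X, Assign C O → ℝ)
    (he : IsEmpiricalModel M e) :
    (StronglyContextual M e ↔ NCF M e = 0) ∧
    (StronglyContextual M e ↔ CF M e = 1) := by
  have h : StronglyContextual M e ↔ NCF M e = 0 := by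
    constructor
    · intro h
      have hw : ∀ w ∈ {w | ∃ b : (X → O) → ℝ, Feasible M e b ∧ ∑ g, b g = w}, w = 0 := by
        rintro w ⟨b, hb, rfl⟩
        exact sum_eq_zero fun g _ => h.eq_zero_of_feasible hb g
      exact le_antisymm (Real.sSup_nonpos fun w hw' => (hw w hw').le)
        (Real.sSup_nonneg fun w hw' => (hw w hw').ge)
    · rintro h ⟨g, hg⟩
      obtain ⟨p, hp, hp1, hpe⟩ := exists_pos_le_one_forall_le M hg
      have hle := (feasible_single (fun C hC => (he.1 C hC).1) hp.le hp1 hpe).sum_le_ncf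
      rw [h, sum_pi_single', if_pos (mem_univ g)] at hle
      exact hp.not_ge hle
  refine ⟨h, h.trans ?_⟩
  rw [CF, sub_eq_self]
end

section
/- (Theorem 1(iii)) Let e be an empirical model on a measurement scenario (X, M, O) with 0 < NCF(e) < 1, and let a be coefficients with a·e' ≤ 0 for every non-contextual empirical model e', ‖a‖ = 1, and a·e = CF(e). Then for any decomposition e = NCF(e) · e^NC + CF(e) · e^SC with e^NC non-contextual and e^SC an empirical model, the Bell inequality (a, 0) is saturated by the non-contextual part and maximally violated by the other part: a·e^NC = 0 and a·e^SC = 1. -/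
open Finset

variable {X O : Type} [Fintype X] [DecidableEq X] [Fintype O] [DecidableEq O]

/-- The pairing `a·e` between inequality coefficients and an empirical model. -/
def dotM {X O : Type} [Fintype X] [DecidableEq X] [Fintype O] [DecidableEq O]
    (M : Finset (Finset X)) (a e : ∀ C : Finset X, Assign C O → ℝ) : ℝ :=
  ∑ C ∈ M, ∑ s, a C s * e C s

/-- The algebraic bound `‖a‖ = Σ_C max_s a[C,s]` of a system of coefficients. -/
noncomputable def normM {X O : Type} [Fintype X] [DecidableEq X] [Fintype O] [DecidableEq O]
    [Nonempty O] (M : Finset (Finset X)) (a : ∀ C : Finset X, Assign C O → ℝ) : ℝ :=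
  ∑ C ∈ M, (univ : Finset (Assign C O)).sup' univ_nonempty (a C)

/-- Contextwise pairing with probability distributions is bounded by the algebraic bound. -/
theorem dotM_le_normM [Nonempty O] (M : Finset (Finset X))
    (a e : ∀ C : Finset X, Assign C O → ℝ) (he : ∀ C ∈ M, IsProb (e C)) :
    dotM M a e ≤ normM M a := by
  refine sum_le_sum fun C hC => ?_
  calc ∑ s, a C s * e C s
      ≤ ∑ s, (univ : Finset (Assign C O)).sup' univ_nonempty (a C) * e C s :=
        sum_le_sum fun s _ =>
          mul_le_mul_of_nonneg_right (le_sup' (a C) (mem_univ s)) ((he C hC).1 s)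
    _ = (univ : Finset (Assign C O)).sup' univ_nonempty (a C) := by
        rw [← mul_sum, (he C hC).2, mul_one]

/-- The pairing is linear in the model. -/
theorem dotM_of_eq_combination (M : Finset (Finset X))
    (a e e₁ e₂ : ∀ C : Finset X, Assign C O → ℝ) (p q : ℝ)
    (h : ∀ C ∈ M, ∀ s, e C s = p * e₁ C s + q * e₂ C s) :
    dotM M a e = p * dotM M a e₁ + q * dotM M a e₂ := by
  simp only [dotM, mul_sum, ← sum_add_distrib]
  refine sum_congr rfl fun C hC => sum_congr rfl fun s _ => ?_
  rw [h C hC s]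
  ring

/-- **Theorem 1(iii).** If `(a, 0)` is a Bell inequality with `‖a‖ = 1`
maximally violated by `e` (`a·e = CF(e)`), then in any decomposition
`e = NCF(e)·e^NC + CF(e)·e^SC` with `e^NC` non-contextual, the inequality is saturated
by `e^NC` and maximally violated by `e^SC`. -/
theorem bell_inequality_saturated_and_maximally_violated
    {X O : Type} [Fintype X] [DecidableEq X] [Fintype O] [DecidableEq O] [Nonempty O]
    (M : Finset (Finset X)) (e : ∀ C : Finset X, Assign C O → ℝ)
    (he : IsEmpiricalModel M e) (h0 : 0 < NCF M e) (h1 : NCF M e < 1)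
    (a : ∀ C : Finset X, Assign C O → ℝ)
    (hBell : ∀ e' : ∀ C : Finset X, Assign C O → ℝ,
      IsEmpiricalModel M e' → NonContextual M e' → dotM M a e' ≤ 0)
    (hnorm : normM M a = 1)
    (hviol : dotM M a e = CF M e) :
    ∀ eNC eSC : ∀ C : Finset X, Assign C O → ℝ,
      IsEmpiricalModel M eNC → NonContextual M eNC → IsEmpiricalModel M eSC →
      (∀ C ∈ M, ∀ s, e C s = NCF M e * eNC C s + CF M e * eSC C s) →
      dotM M a eNC = 0 ∧ dotM M a eSC = 1 := by
  intro eNC eSC hNC hNC' hSC hdec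
  have hlin := dotM_of_eq_combination M a e eNC eSC _ _ hdec
  have hle_zero := hBell eNC hNC hNC'
  have hle_one : dotM M a eSC ≤ 1 := hnorm ▸ dotM_le_normM M a eSC hSC.1
  have hCF : 0 < CF M e := sub_pos.mpr h1
  rw [hviol] at hlin
  constructor <;> nlinarith
end

section
/- (Theorem 2, translation of measurements) Let e be an empirical model on a measurement scenario (X', M', O), let (X, M, O) be a measurement scenario, and let f : X → X' be context-preserving: for each C ∈ M there is some C' ∈ M' with f(C) ⊆ C'. For each C ∈ M fix such a C'_C ∈ M' and define (f^*e)_C(s) = Σ_{t ∈ O^{f(C)}, t ∘ (f|_C) = s} (e_{C'_C}|_{f(C)})(t) for s ∈ O^C. Then f^*e is a well-defined empirical model on (X, M, O) whose values do not depend on the choices C'_C, and CF(f^*e) ≤ CF(e). -/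
open Finset

variable {X O : Type} [Fintype X] [DecidableEq X] [Fintype O] [DecidableEq O]

/-- The pull-back `f^*e` of an empirical model `e` on `(X', M', O)` along a map
`f : X → X'`, where `D` chooses, for each context `C`, a context `D C ∈ M'` containing
`f(C)`: `(f^*e)_C(s) = Σ_{t ∈ O^{f(C)}, t∘f|_C = s} (e_{D C}|_{f(C)})(t)`, written here
directly as a marginal of `e_{D C}`. -/
noncomputable def pullbackModel {X X' O : Type} [Fintype X] [DecidableEq X]
    [Fintype X'] [DecidableEq X'] [Fintype O] [DecidableEq O]
    (e : ∀ C' : Finset X', Assign C' O → ℝ) (f : X → X') (D : Finset X → Finset X') :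
    ∀ C : Finset X, Assign C O → ℝ :=
  fun C s => ∑ s' ∈ univ.filter (fun s' : Assign (D C) O =>
      ∀ x : {x // x ∈ C}, ∀ h : f x.1 ∈ D C, s' ⟨f x.1, h⟩ = s x), e (D C) s'

/-- The pushforward of a weight function along a map of finite types. -/
noncomputable def pushforward {α β : Type} [Fintype α] [DecidableEq β] (φ : α → β) (d : α → ℝ) :
    β → ℝ :=
  fun b => ∑ a ∈ univ.filter (fun a => φ a = b), d a

section Pushforward

variable {α β γ : Type} [Fintype α] [DecidableEq β]

lemma pushforward_pushforward [Fintype β] [DecidableEq γ] (ψ : β → γ) (φ : α → β) (d : α → ℝ) :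
    pushforward ψ (pushforward φ d) = pushforward (fun a => ψ (φ a)) d := by
  funext c
  simp only [pushforward, sum_filter]
  simp_rw [← sum_filter (fun b => ψ b = c), sum_comm (s := univ.filter _), sum_ite_eq]
  simp

lemma sum_pushforward [Fintype β] (φ : α → β) (d : α → ℝ) :
    ∑ b, pushforward φ d b = ∑ a, d a :=
  sum_fiberwise univ φ d

lemma pushforward_nonneg (φ : α → β) {d : α → ℝ} (hd : ∀ a, 0 ≤ d a) (b : β) :
    0 ≤ pushforward φ d b :=
  sum_nonneg fun a _ => hd a

lemma pushforward_mono (φ : α → β) {d d' : α → ℝ} (h : ∀ a, d a ≤ d' a) (b : β) :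
    pushforward φ d b ≤ pushforward φ d' b :=
  sum_le_sum fun a _ => h a

lemma IsProb.pushforward [Fintype β] (φ : α → β) {d : α → ℝ} (hd : IsProb d) :
    IsProb (pushforward φ d) :=
  ⟨pushforward_nonneg φ hd.1, (sum_pushforward φ d).trans hd.2⟩

end Pushforward

section Contexts

variable {X' : Type} [Fintype X'] [DecidableEq X']

/-- Precomposition of assignments on `A` with a map sending `U` into `A`. -/
def pullAssign (f : X → X') {U : Finset X} {A : Finset X'} (h : ∀ x ∈ U, f x ∈ A)
    (s : Assign A O) : Assign U O :=
  fun x => s ⟨f x.1, h x.1 x.2⟩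

lemma marg_eq_pushforward {X O : Type} [DecidableEq X] [Fintype O] [DecidableEq O]
    {C U : Finset X} (h : U ⊆ C) (d : Assign C O → ℝ) :
    marg h d = pushforward (fun s u => s ⟨u.1, h u.2⟩) d := by
  funext t
  simp only [marg, pushforward, funext_iff]

lemma margG_eq_pushforward (C : Finset X) (d : (X → O) → ℝ) :
    margG C d = pushforward (fun g x => g x.1) d := by
  funext t
  simp only [margG, pushforward, funext_iff]

lemma pullbackModel_eq_pushforward (e : ∀ C' : Finset X', Assign C' O → ℝ) (f : X → X')
    (D : Finset X → Finset X') {C : Finset X} (h : ∀ x ∈ C, f x ∈ D C) :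
    pullbackModel e f D C = pushforward (pullAssign f h) (e (D C)) := by
  funext s
  refine sum_congr (filter_congr fun s' _ => ?_) fun _ _ => rfl
  rw [funext_iff]
  exact forall_congr' fun x => ⟨fun hx => hx (h x.1 x.2), fun hx _ => hx⟩

/-- By compatibility, the pull-back of an empirical model to `U` does not depend on the
context containing the image of `U`. -/
lemma IsEmpiricalModel.pushforward_pullAssign_eq {X X' O : Type} [DecidableEq X'] [Fintype O]
    [DecidableEq O] {M' : Finset (Finset X')}
    {e : ∀ C' : Finset X', Assign C' O → ℝ} (he : IsEmpiricalModel M' e) (f : X → X')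
    {U : Finset X} {A B : Finset X'} (hA : A ∈ M') (hB : B ∈ M')
    (hUA : ∀ x ∈ U, f x ∈ A) (hUB : ∀ x ∈ U, f x ∈ B) :
    pushforward (pullAssign f hUA) (e A) = pushforward (pullAssign f hUB) (e B) := by
  have h := he.2 A hA B hB
  rw [marg_eq_pushforward, marg_eq_pushforward] at h
  have h' := congrArg (pushforward
    (pullAssign f fun x hx => mem_inter.2 ⟨hUA x hx, hUB x hx⟩)) h
  rwa [pushforward_pushforward, pushforward_pushforward] at h'

lemma Feasible.pullback {M' : Finset (Finset X')} {e : ∀ C' : Finset X', Assign C' O → ℝ}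
    {b : (X' → O) → ℝ} (hb : Feasible M' e b) {M : Finset (Finset X)} (f : X → X')
    (D : Finset X → Finset X') (hD : ∀ C ∈ M, D C ∈ M' ∧ ∀ x ∈ C, f x ∈ D C) :
    Feasible M (pullbackModel e f D) (pushforward (fun g x => g (f x)) b) := by
  refine ⟨pushforward_nonneg _ hb.1, (sum_pushforward _ b).trans_le hb.2.1, fun C hC t => ?_⟩
  have h := pushforward_mono (pullAssign f (hD C hC).2) (hb.2.2 (D C) (hD C hC).1) t
  rw [margG_eq_pushforward, pushforward_pushforward] at h
  rwa [pullbackModel_eq_pushforward e f D (hD C hC).2, margG_eq_pushforward,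
    pushforward_pushforward]

lemma IsEmpiricalModel.feasible_zero {M : Finset (Finset X)}
    {e : ∀ C : Finset X, Assign C O → ℝ} (he : IsEmpiricalModel M e) : Feasible M e 0 :=
  ⟨fun _ => le_rfl, by simp, fun C hC t => by simpa [margG] using (he.1 C hC).1 t⟩

end Contexts

/-- **Theorem 2, translation of measurements.** Pulling back an empirical
model along a context-preserving map of measurements yields a well-defined empirical
model (independent of the choice of covering contexts) and does not increase the
contextual fraction. -/
theorem contextual_fraction_monotone_translation
    {X X' O : Type} [Fintype X] [DecidableEq X] [Fintype X'] [DecidableEq X']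
    [Fintype O] [DecidableEq O] [Nonempty O]
    (M' : Finset (Finset X')) (e : ∀ C' : Finset X', Assign C' O → ℝ)
    (he : IsEmpiricalModel M' e)
    (M : Finset (Finset X)) (f : X → X')
    (D : Finset X → Finset X')
    (hD : ∀ C ∈ M, D C ∈ M' ∧ C.image f ⊆ D C) :
    IsEmpiricalModel M (pullbackModel e f D) ∧
    (∀ D' : Finset X → Finset X', (∀ C ∈ M, D' C ∈ M' ∧ C.image f ⊆ D' C) →
      ∀ C ∈ M, pullbackModel e f D C = pullbackModel e f D' C) ∧
    CF M (pullbackModel e f D) ≤ CF M' e := by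
  replace hD : ∀ C ∈ M, D C ∈ M' ∧ ∀ x ∈ C, f x ∈ D C :=
    fun C hC => ⟨(hD C hC).1, image_subset_iff.1 (hD C hC).2⟩
  refine ⟨⟨fun C hC => ?_, fun C hC C' hC' => ?_⟩, fun D' hD' C hC => ?_, ?_⟩
  · rw [pullbackModel_eq_pushforward e f D (hD C hC).2]
    exact (he.1 _ (hD C hC).1).pushforward _
  · rw [pullbackModel_eq_pushforward e f D (hD C hC).2,
      pullbackModel_eq_pushforward e f D (hD C' hC').2, marg_eq_pushforward,
      marg_eq_pushforward, pushforward_pushforward, pushforward_pushforward]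
    exact he.pushforward_pullAssign_eq f (hD C hC).1 (hD C' hC').1
      (fun x hx => (hD C hC).2 x (mem_inter.1 hx).1)
      (fun x hx => (hD C' hC').2 x (mem_inter.1 hx).2)
  · have hC' := image_subset_iff.1 (hD' C hC).2
    rw [pullbackModel_eq_pushforward e f D (hD C hC).2,
      pullbackModel_eq_pushforward e f D' hC']
    exact he.pushforward_pullAssign_eq f (hD C hC).1 (hD' C hC).1 _ _
  · refine sub_le_sub_left (csSup_le_csSup ⟨1, ?_⟩ ?_ ?_) 1
    · rintro _ ⟨b, hb, rfl⟩
      exact hb.2.1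
    · exact ⟨_, 0, he.feasible_zero, rfl⟩
    · rintro _ ⟨b, hb, rfl⟩
      exact ⟨_, hb.pullback f D hD, sum_pushforward _ b⟩
end

section
/- (Theorem 2, probabilistic mixing) Let e₁ and e₂ be empirical models on the same measurement scenario (X, M, O) and let λ ∈ [0,1]. Then the contextwise convex combination λ e₁ + (1−λ) e₂ is an empirical model and CF(λ e₁ + (1−λ) e₂) ≤ λ · CF(e₁) + (1−λ) · CF(e₂); that is, CF is a convex function on empirical models. -/
open Finset

variable {X O : Type} [Fintype X] [DecidableEq X] [Fintype O] [DecidableEq O]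

/-- The contextwise convex combination `λ e₁ + (1-λ) e₂` of two empirical models. -/
def mixModel {X O : Type} [Fintype X] [DecidableEq X] [Fintype O] [DecidableEq O]
    (lam : ℝ) (e₁ e₂ : ∀ C : Finset X, Assign C O → ℝ) :
    ∀ C : Finset X, Assign C O → ℝ :=
  fun C s => lam * e₁ C s + (1 - lam) * e₂ C s

theorem marg_mix {C U : Finset X} (h : U ⊆ C) (a b : ℝ) (d₁ d₂ : Assign C O → ℝ) :
    marg h (fun s => a * d₁ s + b * d₂ s) =
      fun t => a * marg h d₁ t + b * marg h d₂ t := by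
  funext t
  simp only [marg, sum_add_distrib, mul_sum]

theorem margG_mix (C : Finset X) (a b : ℝ) (d₁ d₂ : (X → O) → ℝ) (t : Assign C O) :
    margG C (fun g => a * d₁ g + b * d₂ g) t =
      a * margG C d₁ t + b * margG C d₂ t := by
  simp only [margG, sum_add_distrib, mul_sum]

theorem IsProb.mix {α : Type} [Fintype α] {d₁ d₂ : α → ℝ} (h₁ : IsProb d₁)
    (h₂ : IsProb d₂) {lam : ℝ} (h0 : 0 ≤ lam) (h1 : lam ≤ 1) :
    IsProb (fun a => lam * d₁ a + (1 - lam) * d₂ a) := by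
  refine ⟨fun a => add_nonneg (mul_nonneg h0 (h₁.1 a))
    (mul_nonneg (sub_nonneg.2 h1) (h₂.1 a)), ?_⟩
  rw [sum_add_distrib, ← mul_sum, ← mul_sum, h₁.2, h₂.2]
  ring

theorem IsEmpiricalModel.mixModel {M : Finset (Finset X)}
    {e₁ e₂ : ∀ C : Finset X, Assign C O → ℝ} (he₁ : IsEmpiricalModel M e₁)
    (he₂ : IsEmpiricalModel M e₂) {lam : ℝ} (h0 : 0 ≤ lam) (h1 : lam ≤ 1) :
    IsEmpiricalModel M (mixModel lam e₁ e₂) := by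
  refine ⟨fun C hC => (he₁.1 C hC).mix (he₂.1 C hC) h0 h1, fun C hC C' hC' => ?_⟩
  unfold _root_.mixModel
  rw [marg_mix, marg_mix, he₁.2 C hC C' hC', he₂.2 C hC C' hC']

theorem Feasible.mix {M : Finset (Finset X)}
    {e₁ e₂ : ∀ C : Finset X, Assign C O → ℝ} {b₁ b₂ : (X → O) → ℝ}
    (hb₁ : Feasible M e₁ b₁) (hb₂ : Feasible M e₂ b₂) {lam : ℝ} (h0 : 0 ≤ lam)
    (h1 : lam ≤ 1) :
    Feasible M (mixModel lam e₁ e₂) (fun g => lam * b₁ g + (1 - lam) * b₂ g) := by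
  have h1' : 0 ≤ 1 - lam := sub_nonneg.2 h1
  refine ⟨fun g => add_nonneg (mul_nonneg h0 (hb₁.1 g)) (mul_nonneg h1' (hb₂.1 g)), ?_,
    fun C hC t => ?_⟩
  · rw [sum_add_distrib, ← mul_sum, ← mul_sum]
    linarith [mul_le_mul_of_nonneg_left hb₁.2.1 h0, mul_le_mul_of_nonneg_left hb₂.2.1 h1']
  · rw [margG_mix]
    exact add_le_add (mul_le_mul_of_nonneg_left (hb₁.2.2 C hC t) h0)
      (mul_le_mul_of_nonneg_left (hb₂.2.2 C hC t) h1')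

theorem bddAbove_feasible_weights (M : Finset (Finset X))
    (e : ∀ C : Finset X, Assign C O → ℝ) :
    BddAbove {w | ∃ b : (X → O) → ℝ, Feasible M e b ∧ ∑ g, b g = w} := by
  refine ⟨1, ?_⟩
  rintro _ ⟨b, hb, rfl⟩
  exact hb.2.1

theorem IsEmpiricalModel.nonempty_feasible_weights {M : Finset (Finset X)}
    {e : ∀ C : Finset X, Assign C O → ℝ} (he : IsEmpiricalModel M e) :
    {w | ∃ b : (X → O) → ℝ, Feasible M e b ∧ ∑ g, b g = w}.Nonempty :=
  ⟨_, fun _ => 0, ⟨fun _ => le_rfl, by simp,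
    fun C hC t => by simpa [margG] using (he.1 C hC).1 t⟩, rfl⟩

open scoped Pointwise in
theorem IsEmpiricalModel.le_NCF_mixModel {M : Finset (Finset X)}
    {e₁ e₂ : ∀ C : Finset X, Assign C O → ℝ} (he₁ : IsEmpiricalModel M e₁)
    (he₂ : IsEmpiricalModel M e₂) {lam : ℝ} (h0 : 0 ≤ lam) (h1 : lam ≤ 1) :
    lam * NCF M e₁ + (1 - lam) * NCF M e₂ ≤ NCF M (_root_.mixModel lam e₁ e₂) := by
  have h1' : 0 ≤ 1 - lam := sub_nonneg.2 h1
  simp only [NCF, ← smul_eq_mul]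
  rw [← Real.sSup_smul_of_nonneg h0, ← Real.sSup_smul_of_nonneg h1',
    ← csSup_add he₁.nonempty_feasible_weights.smul_set
      ((bddAbove_feasible_weights M e₁).smul_of_nonneg h0)
      he₂.nonempty_feasible_weights.smul_set
      ((bddAbove_feasible_weights M e₂).smul_of_nonneg h1')]
  refine csSup_le_csSup (bddAbove_feasible_weights M _)
    (he₁.nonempty_feasible_weights.smul_set.add he₂.nonempty_feasible_weights.smul_set) ?_
  rintro _ ⟨_, ⟨_, ⟨b₁, hb₁, rfl⟩, rfl⟩, _, ⟨_, ⟨b₂, hb₂, rfl⟩, rfl⟩, rfl⟩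
  exact ⟨_, hb₁.mix hb₂ h0 h1, by simp [sum_add_distrib, mul_sum]⟩

/-- **Theorem 2, probabilistic mixing.** The contextwise convex
combination of empirical models is an empirical model, and `CF` is convex. -/
theorem contextual_fraction_convex_mixing
    {X O : Type} [Fintype X] [DecidableEq X] [Fintype O] [DecidableEq O]
    (M : Finset (Finset X)) (e₁ e₂ : ∀ C : Finset X, Assign C O → ℝ)
    (he₁ : IsEmpiricalModel M e₁) (he₂ : IsEmpiricalModel M e₂)
    (lam : ℝ) (h0 : 0 ≤ lam) (h1 : lam ≤ 1) :
    IsEmpiricalModel M (mixModel lam e₁ e₂) ∧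
    CF M (mixModel lam e₁ e₂) ≤ lam * CF M e₁ + (1 - lam) * CF M e₂ := by
  refine ⟨he₁.mixModel he₂ h0 h1, ?_⟩
  have := he₁.le_NCF_mixModel he₂ h0 h1
  unfold CF
  linarith
end

section
/- (Lemma 6) Let S and T be finite sets and let b_S : S → ℝ≥0 and b_T : T → ℝ≥0 be subprobability distributions. Then there exists a subprobability distribution b : S × T → ℝ≥0 of weight min{|b_S|, |b_T|} such that Σ_{t∈T} b(s,t) ≤ b_S(s) for every s ∈ S and Σ_{s∈S} b(s,t) ≤ b_T(t) for every t ∈ T. -/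
open Finset

/-- **Lemma 6.** Given subprobability distributions on finite sets `S`
and `T`, there is a subprobability distribution on `S × T` of weight
`min(|b_S|, |b_T|)` whose marginals are dominated by the given ones. -/
theorem exists_subcoupling_of_subprobs {S T : Type} [Fintype S] [Fintype T]
    (bS : S → ℝ) (bT : T → ℝ)
    (hS0 : ∀ s, 0 ≤ bS s) (hT0 : ∀ t, 0 ≤ bT t)
    (hS1 : ∑ s, bS s ≤ 1) (hT1 : ∑ t, bT t ≤ 1) :
    ∃ b : S × T → ℝ, (∀ p, 0 ≤ b p) ∧
      (∑ p, b p = min (∑ s, bS s) (∑ t, bT t)) ∧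
      (∀ s, ∑ t, b (s, t) ≤ bS s) ∧ (∀ t, ∑ s, b (s, t) ≤ bT t) := by
  have hA : 0 ≤ ∑ s, bS s := sum_nonneg fun s _ => hS0 s
  have hB : 0 ≤ ∑ t, bT t := sum_nonneg fun t _ => hT0 t
  set A := ∑ s, bS s
  set B := ∑ t, bT t
  have hM : 0 ≤ max A B := le_max_of_le_left hA
  refine ⟨fun p => bS p.1 * bT p.2 / max A B,
    fun p => div_nonneg (mul_nonneg (hS0 _) (hT0 _)) hM, ?_, fun s => ?_, fun t => ?_⟩
  · rw [← sum_div, Fintype.sum_prod_type, ← Fintype.sum_mul_sum]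
    change A * B / max A B = min A B
    rw [← min_mul_max A B]
    refine mul_div_cancel_of_imp fun h => ?_
    exact le_antisymm (h ▸ min_le_max) (le_min hA hB)
  · dsimp only
    rw [← sum_div, ← mul_sum, mul_div_assoc]
    exact mul_le_of_le_one_right (hS0 s) (div_le_one_of_le₀ (le_max_right A B) hM)
  · dsimp only
    rw [← sum_div, ← sum_mul, mul_comm, mul_div_assoc]
    exact mul_le_of_le_one_right (hT0 t) (div_le_one_of_le₀ (le_max_left A B) hM)
end

section
/- (Theorem 4) Let (V, D, Γ) be a constraint system with |Γ| = n formulae and Γ k-consistent (with k < n), and let p = {p_φ}_{φ∈Γ} be a valid strategy with average success probability p_S = (1/n) Σ_{φ∈Γ} Σ_{s∈S_φ} p_φ(s) and average failure probability p_F = 1 − p_S. Then p_F ≥ NCF(p) · (n − k)/n. -/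
open Finset

variable {X O : Type} [Fintype X] [DecidableEq X] [Fintype O] [DecidableEq O]

/-- The non-contextual fraction of a strategy `p` for a constraint system: the maximum
weight of a nonnegative `b` on global assignments whose marginals are dominated by the
`p_φ`. -/
noncomputable def NCFstrategy {V D : Type} [Fintype V] [DecidableEq V]
    [Fintype D] [DecidableEq D] {ι : Type} [Fintype ι]
    (Vf : ι → Finset V) (p : ∀ i, Assign (Vf i) D → ℝ) : ℝ :=
  sSup {w | ∃ b : (V → D) → ℝ, (∀ g, 0 ≤ b g) ∧
    (∀ i, ∀ t, margG (Vf i) b t ≤ p i t) ∧ ∑ g, b g = w}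

/-- Summing a marginal over a set `T` of local assignments gives the weight of the global
assignments whose restriction lies in `T`. -/
theorem sum_margG_eq_sum_ite {V D : Type} [Fintype V] [DecidableEq V] [Fintype D]
    [DecidableEq D] (C : Finset V) (b : (V → D) → ℝ) (T : Finset (Assign C D)) :
    ∑ t ∈ T, margG C b t = ∑ g, if (fun x : {v // v ∈ C} => g x.1) ∈ T then b g else 0 := by
  simp only [margG, sum_filter]
  rw [sum_comm]
  refine sum_congr rfl fun g _ => ?_
  rw [← sum_ite_eq T (fun x : {v // v ∈ C} => g x.1) (fun _ => b g)]
  refine sum_congr rfl fun t _ => ?_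
  simp only [funext_iff]

/-- If no global assignment satisfies more than `k` formulae, then any nonnegative weight on
global assignments with marginals dominated by `p` forces failure weight in `p`. -/
theorem sum_mul_le_sum_compl_of_margG_le
    {V D : Type} [Fintype V] [DecidableEq V] [Fintype D] [DecidableEq D]
    {ι : Type} [Fintype ι]
    (Vf : ι → Finset V) (Sf : ∀ i, Finset (Assign (Vf i) D)) (k : ℕ)
    (hk : ∀ g : V → D,
      (univ.filter (fun i => (fun x : {v // v ∈ Vf i} => g x.1) ∈ Sf i)).card ≤ k)
    (p : ∀ i, Assign (Vf i) D → ℝ) (b : (V → D) → ℝ) (hb : ∀ g, 0 ≤ b g)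
    (hle : ∀ i, ∀ t, margG (Vf i) b t ≤ p i t) :
    (∑ g, b g) * ((Fintype.card ι : ℝ) - k) ≤ ∑ i, ∑ s ∈ (Sf i)ᶜ, p i s := by
  calc (∑ g, b g) * ((Fintype.card ι : ℝ) - k)
      ≤ ∑ g, ∑ i, if (fun x : {v // v ∈ Vf i} => g x.1) ∈ (Sf i)ᶜ then b g else 0 := by
        rw [sum_mul]
        refine sum_le_sum fun g _ => ?_
        simp only [mem_compl]
        rw [← sum_filter, sum_const, nsmul_eq_mul, mul_comm]
        refine mul_le_mul_of_nonneg_right ?_ (hb g)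
        have hcard := card_filter_add_card_filter_not (s := (univ : Finset ι))
          (fun i => (fun x : {v // v ∈ Vf i} => g x.1) ∈ Sf i)
        rw [card_univ] at hcard
        rw [← hcard, Nat.cast_add]
        have : (_ : ℝ) ≤ k := Nat.cast_le.mpr (hk g)
        linarith
    _ = ∑ i, ∑ s ∈ (Sf i)ᶜ, margG (Vf i) b s := by
        rw [sum_comm]
        exact sum_congr rfl fun i _ => (sum_margG_eq_sum_ite (Vf i) b _).symm
    _ ≤ ∑ i, ∑ s ∈ (Sf i)ᶜ, p i s :=
        sum_le_sum fun i _ => sum_le_sum fun s _ => hle i s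

/-- **Theorem 4.** For a constraint system with `n` formulae that is
`k`-consistent (`k < n`) and a valid strategy `p` with average success probability
`p_S` and failure probability `p_F = 1 − p_S`, we have `p_F ≥ NCF(p)·(n−k)/n`. -/
theorem average_failure_ge_ncf_mul_hardness
    {V D : Type} [Fintype V] [DecidableEq V] [Fintype D] [DecidableEq D]
    {ι : Type} [Fintype ι]
    (Vf : ι → Finset V) (Sf : ∀ i, Finset (Assign (Vf i) D)) (k n : ℕ)
    (hn : n = Fintype.card ι) (hkn : k < n)
    (hk : ∀ g : V → D,
      (univ.filter (fun i => (fun x : {v // v ∈ Vf i} => g x.1) ∈ Sf i)).card ≤ k)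
    (p : ∀ i, Assign (Vf i) D → ℝ)
    (hp : ∀ i, IsProb (p i))
    (hcompat : ∀ i j : ι,
      marg (inter_subset_left : Vf i ∩ Vf j ⊆ Vf i) (p i) =
      marg (inter_subset_right : Vf i ∩ Vf j ⊆ Vf j) (p j))
    (pS pF : ℝ)
    (hpS : pS = (1 / (n : ℝ)) * ∑ i, ∑ s ∈ Sf i, p i s)
    (hpF : pF = 1 - pS) :
    pF ≥ NCFstrategy Vf p * (((n : ℝ) - (k : ℝ)) / (n : ℝ)) := by
  have hnpos : (0 : ℝ) < n := by exact_mod_cast (Nat.zero_le k).trans_lt hkn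
  have hgap : (0 : ℝ) < (n : ℝ) - k := sub_pos.mpr (Nat.cast_lt.mpr hkn)
  have hfail : ∑ i, ∑ s ∈ (Sf i)ᶜ, p i s = n * pF := by
    have hsum : ∑ i, (∑ s ∈ Sf i, p i s + ∑ s ∈ (Sf i)ᶜ, p i s) = n := by
      simp only [sum_add_sum_compl, (hp _).2, hn, sum_const, card_univ, nsmul_eq_mul, mul_one]
    rw [sum_add_distrib] at hsum
    rw [hpF, hpS]
    field_simp
    linarith
  have hsup : NCFstrategy Vf p ≤ n * pF / ((n : ℝ) - k) := by
    refine csSup_le ⟨0, 0, fun _ => le_rfl, fun i t => ?_, by simp⟩ ?_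
    · simpa [margG] using (hp i).1 t
    · rintro w ⟨b, hb, hle, rfl⟩
      rw [le_div_iff₀ hgap, ← hfail, hn]
      exact sum_mul_le_sum_compl_of_margG_le Vf Sf k hk p b hb hle
  rw [le_div_iff₀ hgap] at hsup
  rw [ge_iff_le, ← mul_div_assoc, div_le_iff₀ hnpos]
  linarith
end

section
/- (Theorem 3) Let e = (e_q)_{q∈ℤ₂ⁿ} be an (n,2,2) empirical model, let Q be an n×m matrix, T an n×n strictly lower triangular matrix (T_{jk} = 0 whenever k ≥ j), and Z an l×n matrix, all over ℤ₂, and let f : ℤ₂^m → ℤ₂^l. Define the average success probability p̄_S = 2^{−m} Σ_{i∈ℤ₂^m} Σ_{s∈ℤ₂ⁿ, Zs = f(i)} e_{Qi + Ts}(s), and let ν̃(f) be the minimum over all ℤ₂-affine functions h : ℤ₂^m → ℤ₂^l (i.e., h(x) = Ax + c for an l×m matrix A over ℤ₂ and c ∈ ℤ₂^l) of the average distance d̃(f,h) = 2^{−m} · |{ i ∈ ℤ₂^m : f(i) ≠ h(i) }|. Then the average failure probability satisfies 1 − p̄_S ≥ NCF(e) · ν̃(f). -/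
open Finset

/-- An `(n,2,2)` empirical model: a probability distribution `e q` on joint outcomes
`ℤ₂ⁿ` for each choice of measurement settings `q ∈ ℤ₂ⁿ`, satisfying no-signalling. -/
def IsModel22 (n : ℕ) (e : (Fin n → ZMod 2) → (Fin n → ZMod 2) → ℝ) : Prop :=
  (∀ q, IsProb (e q)) ∧
  ∀ q q' : Fin n → ZMod 2, ∀ t : {j // q j = q' j} → ZMod 2,
    ∑ s ∈ univ.filter (fun s : Fin n → ZMod 2 => ∀ j : {j // q j = q' j}, s j.1 = t j),
      e q s =
    ∑ s ∈ univ.filter (fun s : Fin n → ZMod 2 => ∀ j : {j // q j = q' j}, s j.1 = t j),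
      e q' s

/-- The non-contextual fraction of an `(n,2,2)` empirical model: the maximum weight of
a nonnegative `b` on global assignments (a value `g (j, x)` for each party `j` and
measurement setting `x`) whose marginals are dominated by `e`. -/
noncomputable def NCF22 (n : ℕ) (e : (Fin n → ZMod 2) → (Fin n → ZMod 2) → ℝ) : ℝ :=
  sSup {w | ∃ b : (Fin n × ZMod 2 → ZMod 2) → ℝ, (∀ g, 0 ≤ b g) ∧
    (∀ q s : Fin n → ZMod 2,
      ∑ g ∈ univ.filter (fun g : Fin n × ZMod 2 → ZMod 2 => ∀ j, g (j, q j) = s j), b g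
        ≤ e q s) ∧
    ∑ g, b g = w}

/-- No-signalling for two settings that differ at most at the party `k`. -/
theorem IsModel22.sum_eq_of_agree_off {n : ℕ} {e : (Fin n → ZMod 2) → (Fin n → ZMod 2) → ℝ}
    (he : IsModel22 n e) (k : Fin n) {q q' : Fin n → ZMod 2} (hq : ∀ j, j ≠ k → q j = q' j)
    (u : Fin n → ZMod 2) :
    ∑ s ∈ univ.filter (fun s : Fin n → ZMod 2 => ∀ j, j ≠ k → s j = u j), e q s =
    ∑ s ∈ univ.filter (fun s : Fin n → ZMod 2 => ∀ j, j ≠ k → s j = u j), e q' s := by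
  by_cases hk : q k = q' k
  · have : q = q' := by
      funext j
      by_cases hj : j = k
      · rw [hj, hk]
      · exact hq j hj
    rw [this]
  · have hiff : ∀ s : Fin n → ZMod 2, (∀ j, j ≠ k → s j = u j) ↔
        ∀ j : {j // q j = q' j}, s j.1 = u j.1 := fun s =>
      ⟨fun h j => h j.1 fun hj => hk (hj ▸ j.2), fun h j hj => h ⟨j, hq j hj⟩⟩
    simp only [hiff]
    exact he.2 q q' fun j => u j.1

/-- A sum over all functions may be computed after fixing all values but the one at `k`. -/
theorem sum_eq_of_fiberwise_off {n : ℕ} {α : Type*} [Fintype α] [DecidableEq α]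
    [Inhabited α] (k : Fin n) (F G : (Fin n → α) → ℝ)
    (h : ∀ u : Fin n → α, ∑ s ∈ univ.filter (fun s : Fin n → α => ∀ j, j ≠ k → s j = u j), F s =
      ∑ s ∈ univ.filter (fun s : Fin n → α => ∀ j, j ≠ k → s j = u j), G s) :
    ∑ s, F s = ∑ s, G s := by
  rw [← sum_fiberwise univ (fun s : Fin n → α => Function.update s k default) F,
    ← sum_fiberwise univ (fun s : Fin n → α => Function.update s k default) G]
  refine sum_congr rfl fun u _ => ?_
  by_cases hu : u k = default
  · have hiff : ∀ s : Fin n → α, Function.update s k default = u ↔ ∀ j, j ≠ k → s j = u j := by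
      intro s
      rw [Function.update_eq_iff]
      exact ⟨fun h => h.2, fun h => ⟨hu.symm, h⟩⟩
    simp only [hiff]
    exact h u
  · have hne : ∀ s : Fin n → α, Function.update s k default ≠ u := by
      rintro s rfl
      exact hu (Function.update_self ..)
    simp [hne]

/-- Adaptive choice of settings preserves total probability: if the setting of party `j` depends
only on outcomes of earlier parties, the resulting outcome weights sum to one. -/
theorem IsModel22.sum_adaptive_eq_one {n : ℕ} {e : (Fin n → ZMod 2) → (Fin n → ZMod 2) → ℝ}
    (he : IsModel22 n e) (q : (Fin n → ZMod 2) → Fin n → ZMod 2)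
    (hq : ∀ s s' j, (∀ k, k < j → s k = s' k) → q s j = q s' j) :
    ∑ s, e (q s) s = 1 := by
  have key : ∀ k : ℕ, k ≤ n → ∑ s, e (fun j => if j.1 < k then q s j else 0) s = 1 := by
    intro k
    induction k with
    | zero => intro _; simpa using (he.1 fun _ => 0).2
    | succ k ih =>
      intro hk
      rw [← ih (by omega)]
      refine sum_eq_of_fiberwise_off (⟨k, hk⟩ : Fin n) _ _ fun u => ?_
      have hconst : ∀ r, r ≤ k + 1 →
          ∑ s ∈ univ.filter (fun s : Fin n → ZMod 2 => ∀ j, j ≠ ⟨k, hk⟩ → s j = u j),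
            e (fun j => if j.1 < r then q s j else 0) s =
          ∑ s ∈ univ.filter (fun s : Fin n → ZMod 2 => ∀ j, j ≠ ⟨k, hk⟩ → s j = u j),
            e (fun j => if j.1 < r then q u j else 0) s := by
        intro r hr
        refine sum_congr rfl fun s hs => ?_
        congr 1
        funext j
        split_ifs with hj
        · refine hq s u j fun i hi => (mem_filter.mp hs).2 i ?_
          rintro rfl
          have : k < j.1 := hi
          omega
        · rfl
      rw [hconst (k + 1) le_rfl, hconst k (by omega)]
      refine he.sum_eq_of_agree_off _ (fun j hj => ?_) u
      have : j.1 ≠ k := fun h => hj (Fin.ext h)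
      have hiff : j.1 < k + 1 ↔ j.1 < k := by omega
      simp only [hiff]
  simpa using key n le_rfl

/-- A deterministic assignment makes an adaptive linear computation affine: its outcomes can be
chosen to depend affinely on the input. -/
theorem exists_affine_outcomes {n m : ℕ} (Q : Matrix (Fin n) (Fin m) (ZMod 2))
    (T : Matrix (Fin n) (Fin n) (ZMod 2)) (hT : ∀ j k : Fin n, j ≤ k → T j k = 0)
    (g : Fin n × ZMod 2 → ZMod 2) :
    ∃ (B : Matrix (Fin n) (Fin m) (ZMod 2)) (a : Fin n → ZMod 2), ∀ i j,
      g (j, (Q.mulVec i + T.mulVec (B.mulVec i + a)) j) = (B.mulVec i + a) j := by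
  set D : Matrix (Fin n) (Fin n) (ZMod 2) := Matrix.diagonal fun j => g (j, 1) - g (j, 0) with hD
  set a₀ : Fin n → ZMod 2 := fun j => g (j, 0)
  have hg : ∀ (x : Fin n → ZMod 2) j, g (j, x j) = (D.mulVec x + a₀) j := by
    have h01 : ∀ x : ZMod 2, x = 0 ∨ x = 1 := by decide
    intro x j
    rw [Pi.add_apply, hD, Matrix.mulVec_diagonal]
    rcases h01 (x j) with h | h <;> simp [h, a₀]
  have hdet : (1 - D * T).det = 1 := by
    rw [Matrix.det_of_isLowerTriangular]
    · exact prod_eq_one fun j _ => by simp [hD, hT j j le_rfl]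
    · intro j k hjk
      have hjk : j < k := hjk
      simp [hD, hT j k hjk.le, hjk.ne]
  have hinv : (1 - D * T) * (1 - D * T)⁻¹ = 1 := Matrix.mul_nonsing_inv _ (by simp [hdet])
  refine ⟨(1 - D * T)⁻¹ * (D * Q), (1 - D * T)⁻¹.mulVec a₀, fun i j => ?_⟩
  rw [hg]
  refine congrFun ?_ j
  set s := ((1 - D * T)⁻¹ * (D * Q)).mulVec i + (1 - D * T)⁻¹.mulVec a₀ with hs
  have hsolve : (1 - D * T).mulVec s = (D * Q).mulVec i + a₀ := by
    rw [hs, Matrix.mulVec_add, Matrix.mulVec_mulVec, Matrix.mulVec_mulVec, ← Matrix.mul_assoc, hinv,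
      Matrix.one_mul, Matrix.one_mulVec]
  rw [Matrix.sub_mulVec, Matrix.one_mulVec, sub_eq_iff_eq_add] at hsolve
  rw [Matrix.mulVec_add, Matrix.mulVec_mulVec, Matrix.mulVec_mulVec]
  nth_rw 2 [hsolve]
  abel

/-- **Theorem 3.** For an `l2`-MBQC with resource `e`, pre-processing
`Q`, flow `T` (strictly lower triangular) and post-processing `Z`, attempting to compute
`f : ℤ₂^m → ℤ₂^l`, the average failure probability is at least `NCF(e) · ν̃(f)`, where
`ν̃(f)` is the average distance from `f` to the closest `ℤ₂`-affine function. -/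
theorem mbqc_failure_ge_ncf_mul_nonlinearity
    (n m l : ℕ) (e : (Fin n → ZMod 2) → (Fin n → ZMod 2) → ℝ)
    (he : IsModel22 n e)
    (Q : Matrix (Fin n) (Fin m) (ZMod 2))
    (T : Matrix (Fin n) (Fin n) (ZMod 2))
    (hT : ∀ j k : Fin n, j ≤ k → T j k = 0)
    (Z : Matrix (Fin l) (Fin n) (ZMod 2))
    (f : (Fin m → ZMod 2) → (Fin l → ZMod 2))
    (pS : ℝ)
    (hpS : pS = ((2 : ℝ) ^ m)⁻¹ *
      ∑ i : Fin m → ZMod 2,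
        ∑ s ∈ univ.filter (fun s : Fin n → ZMod 2 => Z.mulVec s = f i),
          e (Q.mulVec i + T.mulVec s) s)
    (nu : ℝ)
    (hnu : nu = sInf {d : ℝ | ∃ (A : Matrix (Fin l) (Fin m) (ZMod 2))
        (c : Fin l → ZMod 2),
      d = ((2 : ℝ) ^ m)⁻¹ *
        ((univ.filter (fun i : Fin m → ZMod 2 => f i ≠ A.mulVec i + c)).card : ℝ)}) :
    1 - pS ≥ NCF22 n e * nu := by
  classical
  set S := {d : ℝ | ∃ (A : Matrix (Fin l) (Fin m) (ZMod 2)) (c : Fin l → ZMod 2),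
      d = ((2 : ℝ) ^ m)⁻¹ *
        ((univ.filter (fun i : Fin m → ZMod 2 => f i ≠ A.mulVec i + c)).card : ℝ)}
  have hS : ∀ d ∈ S, 0 ≤ d := by
    rintro d ⟨A, c, rfl⟩
    positivity
  have hnu0 : 0 ≤ nu := hnu ▸ Real.sInf_nonneg hS
  have hnu_le : ∀ (A : Matrix (Fin l) (Fin m) (ZMod 2)) (c : Fin l → ZMod 2),
      nu ≤ ((2 : ℝ) ^ m)⁻¹ *
        ((univ.filter (fun i : Fin m → ZMod 2 => f i ≠ A.mulVec i + c)).card : ℝ) :=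
    fun A c => hnu ▸ csInf_le ⟨0, hS⟩ ⟨A, c, rfl⟩
  have hfail : 1 - pS = ((2 : ℝ) ^ m)⁻¹ * ∑ i : Fin m → ZMod 2,
      ∑ s ∈ univ.filter (fun s : Fin n → ZMod 2 => ¬ Z.mulVec s = f i),
        e (Q.mulVec i + T.mulVec s) s := by
    have htotal : ∀ i : Fin m → ZMod 2, ∑ s, e (Q.mulVec i + T.mulVec s) s = 1 := by
      refine fun i => he.sum_adaptive_eq_one (fun s => Q.mulVec i + T.mulVec s) ?_
      intro s s' j h
      simp only [Pi.add_apply, Matrix.mulVec, dotProduct]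
      refine congrArg _ (sum_congr rfl fun k _ => ?_)
      rcases lt_or_ge k j with hk | hk
      · rw [h k hk]
      · simp [hT j k hk]
    have hsum := sum_congr rfl fun i (_ : i ∈ (univ : Finset (Fin m → ZMod 2))) =>
      (sum_filter_add_sum_filter_not univ (fun s : Fin n → ZMod 2 => Z.mulVec s = f i)
        fun s => e (Q.mulVec i + T.mulVec s) s).trans (htotal i)
    rw [sum_add_distrib] at hsum
    have hcard : ∑ _i : Fin m → ZMod 2, (1 : ℝ) = 2 ^ m := by simp
    rw [hpS, eq_sub_of_add_eq' hsum, hcard, mul_sub, inv_mul_cancel₀ (by positivity)]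
  have hbound : ∀ b : (Fin n × ZMod 2 → ZMod 2) → ℝ, (∀ g, 0 ≤ b g) →
      (∀ q s : Fin n → ZMod 2,
        ∑ g ∈ univ.filter (fun g : Fin n × ZMod 2 → ZMod 2 => ∀ j, g (j, q j) = s j), b g
          ≤ e q s) → (∑ g, b g) * nu ≤ 1 - pS := by
    intro b hb hbe
    choose B a hBa using fun g => exists_affine_outcomes Q T hT g
    calc (∑ g, b g) * nu
        ≤ ∑ g, b g * (((2 : ℝ) ^ m)⁻¹ * ((univ.filter (fun i : Fin m → ZMod 2 =>
            f i ≠ (Z * B g).mulVec i + Z.mulVec (a g))).card : ℝ)) := by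
          rw [sum_mul]
          exact sum_le_sum fun g _ => mul_le_mul_of_nonneg_left (hnu_le _ _) (hb g)
      _ = ((2 : ℝ) ^ m)⁻¹ * ∑ i : Fin m → ZMod 2, ∑ g,
            if f i ≠ (Z * B g).mulVec i + Z.mulVec (a g) then b g else 0 := by
          rw [sum_comm, mul_sum]
          refine sum_congr rfl fun g _ => ?_
          rw [← sum_filter, sum_const, nsmul_eq_mul]
          ring
      _ ≤ 1 - pS := by
          rw [hfail]
          refine mul_le_mul_of_nonneg_left (sum_le_sum fun i _ => ?_) (by positivity)
          refine le_trans ?_ (sum_le_sum fun s _ => hbe (Q.mulVec i + T.mulVec s) s)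
          simp only [sum_filter (p := fun g : Fin n × ZMod 2 → ZMod 2 => ∀ j, _ = _)]
          rw [sum_comm]
          refine sum_le_sum fun g _ => ?_
          have hnonneg : ∀ s ∈ univ.filter (fun s : Fin n → ZMod 2 => ¬ Z.mulVec s = f i),
              0 ≤ if ∀ j, g (j, (Q.mulVec i + T.mulVec s) j) = s j then b g else 0 :=
            fun s _ => by split_ifs <;> simp [hb g]
          split_ifs with hne
          · refine le_trans ?_ (single_le_sum hnonneg (a := (B g).mulVec i + a g) ?_)
            · rw [if_pos (hBa g i)]
            · rw [mem_filter, Matrix.mulVec_add, Matrix.mulVec_mulVec]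
              exact ⟨mem_univ _, fun h => hne h.symm⟩
          · exact sum_nonneg hnonneg
  have hzero : ∀ q s : Fin n → ZMod 2,
      ∑ g ∈ univ.filter (fun g : Fin n × ZMod 2 → ZMod 2 => ∀ j, g (j, q j) = s j),
        (0 : (Fin n × ZMod 2 → ZMod 2) → ℝ) g ≤ e q s := by
    simpa using fun q s => (he.1 q).1 s
  rcases hnu0.eq_or_lt with h0 | hpos
  · simpa [← h0] using hbound 0 (fun _ => le_rfl) hzero
  · rw [ge_iff_le, ← le_div_iff₀ hpos]
    refine csSup_le ⟨_, 0, fun _ => le_rfl, hzero, rfl⟩ ?_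
    rintro w ⟨b, hb, hbe, rfl⟩
    rw [le_div_iff₀ hpos]
    exact hbound b hb hbe
end

section
/- Let e = (e_q)_{q∈ℤ₂ⁿ} be an (n,2,2) empirical model and let F : ℤ₂ⁿ → ℤ₂ⁿ be a map whose j-th component depends only on the coordinates with smaller index: for all s, s' ∈ ℤ₂ⁿ and all j, if s_k = s'_k for all k < j then F(s)_j = F(s')_j (for instance F(s) = Qi + Ts with T strictly lower triangular). Then Σ_{s∈ℤ₂ⁿ} e_{F(s)}(s) = 1; that is, the adaptive measurement protocol determined by F yields a well-defined probability distribution on outcome vectors. -/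
open Finset

/-- No-signalling for coarse-grained events: settings `q` and `q'` give the same weight to an
event determined by the outcomes of the parties on whose settings they agree. -/
theorem IsModel22.sum_filter_eq {n : ℕ} {e : (Fin n → ZMod 2) → (Fin n → ZMod 2) → ℝ}
    (he : IsModel22 n e) (q q' : Fin n → ZMod 2) (P : (Fin n → ZMod 2) → Prop) [DecidablePred P]
    (hP : ∀ s s' : Fin n → ZMod 2, (∀ j, q j = q' j → s j = s' j) → P s → P s') :
    ∑ s with P s, e q s = ∑ s with P s, e q' s := by
  let r : (Fin n → ZMod 2) → {j // q j = q' j} → ZMod 2 := fun s j => s j.1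
  rw [← sum_fiberwise (univ.filter P) r (e q), ← sum_fiberwise (univ.filter P) r (e q')]
  refine sum_congr rfl fun t _ => ?_
  by_cases h : ∃ s₀, P s₀ ∧ r s₀ = t
  · obtain ⟨s₀, hs₀, rfl⟩ := h
    have fiber : (univ.filter P).filter (fun s => r s = r s₀) =
        univ.filter (fun s : Fin n → ZMod 2 => ∀ j : {j // q j = q' j}, s j.1 = r s₀ j) := by
      ext s
      simp only [mem_filter, mem_univ, true_and]
      exact ⟨fun h => congrFun h.2, fun h =>
        ⟨hP s₀ s (fun j hj => (h ⟨j, hj⟩).symm) hs₀, funext h⟩⟩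
    rw [fiber]
    exact he.2 q q' (r s₀)
  · have fiber : (univ.filter P).filter (fun s => r s = t) = ∅ := by
      ext s
      simp only [mem_filter, mem_univ, true_and, notMem_empty, iff_false]
      exact fun hs => h ⟨s, hs⟩
    simp [fiber]

/-- The first `m` entries of `s`, padded with zeros. -/
def zeroPad {n : ℕ} (m : ℕ) (s : Fin n → ZMod 2) : Fin n → ZMod 2 :=
  fun j => if j.1 < m then s j else 0

theorem zeroPad_eq_iff {n : ℕ} {m : ℕ} {s s' : Fin n → ZMod 2} :
    zeroPad m s = zeroPad m s' ↔ ∀ j : Fin n, j.1 < m → s j = s' j := by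
  simp only [funext_iff, zeroPad]
  exact forall_congr' fun j => by by_cases h : j.1 < m <;> simp [h]

/-- Letting one more party choose its setting adaptively does not change the total weight. -/
theorem IsModel22.sum_zeroPad_succ {n : ℕ} {e : (Fin n → ZMod 2) → (Fin n → ZMod 2) → ℝ}
    (he : IsModel22 n e) {F : (Fin n → ZMod 2) → (Fin n → ZMod 2)}
    (hF : ∀ s s' : Fin n → ZMod 2, ∀ j : Fin n,
      (∀ k : Fin n, k < j → s k = s' k) → F s j = F s' j) (m : ℕ) :
    ∑ s, e (zeroPad (m + 1) (F s)) s = ∑ s, e (zeroPad m (F s)) s := by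
  rw [← sum_fiberwise univ (zeroPad m) (fun s => e (zeroPad (m + 1) (F s)) s),
    ← sum_fiberwise univ (zeroPad m) (fun s => e (zeroPad m (F s)) s)]
  refine sum_congr rfl fun p _ => ?_
  by_cases h : ∃ s₀, zeroPad m s₀ = p
  · obtain ⟨s₀, rfl⟩ := h
    have settings (k : ℕ) (hk : k ≤ m + 1) (s : Fin n → ZMod 2)
        (hs : zeroPad m s = zeroPad m s₀) :
        zeroPad k (F s) = zeroPad k (F s₀) :=
      zeroPad_eq_iff.2 fun j hj => hF s s₀ j fun i hi =>
        zeroPad_eq_iff.1 hs i (by have : i.1 < j.1 := hi; omega)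
    calc ∑ s with zeroPad m s = zeroPad m s₀, e (zeroPad (m + 1) (F s)) s
        = ∑ s with zeroPad m s = zeroPad m s₀, e (zeroPad (m + 1) (F s₀)) s :=
          sum_congr rfl fun s hs => by rw [settings _ le_rfl s (mem_filter.1 hs).2]
      _ = ∑ s with zeroPad m s = zeroPad m s₀, e (zeroPad m (F s₀)) s := by
          refine he.sum_filter_eq _ _ _ fun s s' hss' hs => ?_
          rw [← hs, zeroPad_eq_iff]
          exact fun j hj => (hss' j (by simp [zeroPad, hj, Nat.lt_succ_of_lt hj])).symm
      _ = ∑ s with zeroPad m s = zeroPad m s₀, e (zeroPad m (F s)) s :=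
          sum_congr rfl fun s hs => by rw [settings _ m.le_succ s (mem_filter.1 hs).2]
  · have fiber : univ.filter (fun s : Fin n → ZMod 2 => zeroPad m s = p) = ∅ := by
      ext s
      simp only [mem_filter, mem_univ, true_and, notMem_empty, iff_false]
      exact fun hs => h ⟨s, hs⟩
    simp [fiber]

/-- If `F : ℤ₂ⁿ → ℤ₂ⁿ` is an adaptive choice of measurement settings
(its `j`-th component depends only on outcomes of strictly earlier parties), then for
any `(n,2,2)` empirical model `e`, the adaptive protocol determined by `F` yields a
probability distribution on outcomes: `Σ_s e_{F(s)}(s) = 1`. -/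
theorem adaptive_protocol_total_probability
    (n : ℕ) (e : (Fin n → ZMod 2) → (Fin n → ZMod 2) → ℝ)
    (he : IsModel22 n e)
    (F : (Fin n → ZMod 2) → (Fin n → ZMod 2))
    (hF : ∀ s s' : Fin n → ZMod 2, ∀ j : Fin n,
      (∀ k : Fin n, k < j → s k = s' k) → F s j = F s' j) :
    ∑ s : Fin n → ZMod 2, e (F s) s = 1 := by
  have total (m : ℕ) : ∑ s, e (zeroPad m (F s)) s = 1 := by
    induction m with
    | zero => simpa +unfoldPartialApp [zeroPad] using (he.1 fun _ => 0).2
    | succ m ih => rw [he.sum_zeroPad_succ hF, ih]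
  simpa +unfoldPartialApp [zeroPad] using total n
end
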